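/- Let p and q be strictly positive, twice continuously differentiable probability densities on ℝ satisfying ∫ p·((log p)′)² < ∞, ∫ p·((log q)′)² < ∞, ∫ p·|(log p)″| < ∞, ∫ p·|(log q)″| < ∞, and the boundary conditions p(y)·(log p)′(y) → 0 and p(y)·(log q)′(y) → 0 as y → ±∞. For a positive C² density r, define the Hyvärinen score S_H(y; r) = ½((log r)′(y))² + (log r)″(y). Then ∫_ℝ p(y)·[S_H(y; p) − S_H(y; q)] dy ≤ 0, with equality if and only if (log p)′(y) = (log q)′(y) for every y ∈ ℝ. -/

import Mathlib

open MeasureTheory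

/-- The Hyvärinen score of a positive `C²` density `r` on `ℝ`:
`S_H(y; r) = ½((log r)′(y))² + (log r)″(y)`. -/
noncomputable def hyvarinenScore (r : ℝ → ℝ) (y : ℝ) : ℝ :=
  (1 / 2) * (deriv (fun z => Real.log (r z)) y) ^ 2 +
    deriv (deriv (fun z => Real.log (r z))) y

/-- The derivative of the logarithm of a positive `C²` function is `C¹`. -/
theorem contDiff_deriv_log {r : ℝ → ℝ} (hr_pos : ∀ y, 0 < r y) (hr : ContDiff ℝ 2 r) :
    ContDiff ℝ 1 (deriv (fun z => Real.log (r z))) := by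
  have h : ContDiff ℝ 2 (fun z => Real.log (r z)) := hr.log fun y => (hr_pos y).ne'
  exact ((contDiff_succ_iff_deriv (n := 1)).1 (by simpa [one_add_one_eq_two] using h)).2.2

/-- A positive differentiable function satisfies `r′ = r · (log r)′`. -/
theorem hasDerivAt_mul_deriv_log {r : ℝ → ℝ} {y : ℝ} (hr_pos : 0 < r y)
    (hr : DifferentiableAt ℝ r y) :
    HasDerivAt r (r y * deriv (fun z => Real.log (r z)) y) y := by
  rw [deriv.log hr hr_pos.ne', mul_div_cancel₀ _ hr_pos.ne']
  exact hr.hasDerivAt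

/-- The weighted square of a difference is integrable if both weighted squares are. -/
theorem integrable_mul_sub_sq {w f g : ℝ → ℝ} (hw_nonneg : ∀ y, 0 ≤ w y)
    (hw : Continuous w) (hf : Continuous f) (hg : Continuous g)
    (hwf : Integrable (fun y => w y * f y ^ 2)) (hwg : Integrable (fun y => w y * g y ^ 2)) :
    Integrable (fun y => w y * (f y - g y) ^ 2) := by
  refine ((hwf.add hwg).const_mul 2).mono'
    (by fun_prop : Continuous fun y => w y * (f y - g y) ^ 2).aestronglyMeasurable
    (Filter.Eventually.of_forall fun y => ?_)
  rw [Real.norm_of_nonneg (mul_nonneg (hw_nonneg y) (sq_nonneg _))]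
  simp only [Pi.add_apply]
  nlinarith [mul_nonneg (hw_nonneg y) (sq_nonneg (f y + g y))]

/-- A continuous function is integrable against a nonnegative continuous weight as soon as its
absolute value is. -/
theorem integrable_mul_of_integrable_mul_abs {w f : ℝ → ℝ} (hw_nonneg : ∀ y, 0 ≤ w y)
    (hw : Continuous w) (hf : Continuous f) (hwf : Integrable (fun y => w y * |f y|)) :
    Integrable (fun y => w y * f y) := by
  refine hwf.mono' (by fun_prop : Continuous fun y => w y * f y).aestronglyMeasurable
    (Filter.Eventually.of_forall fun y => ?_)
  rw [norm_mul, Real.norm_of_nonneg (hw_nonneg y), Real.norm_eq_abs]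

/-- Negative drift property of the Hyvärinen score difference: under the true model `p`,
the expected score difference `∫ p·(S_H(·;p) − S_H(·;q))` is nonpositive, and it
vanishes if and only if the score functions of `p` and `q` coincide everywhere. -/
theorem expected_hyvarinen_score_difference_nonpos
    (p q : ℝ → ℝ)
    (hp_pos : ∀ y, 0 < p y) (hq_pos : ∀ y, 0 < q y)
    (hp_smooth : ContDiff ℝ 2 p) (hq_smooth : ContDiff ℝ 2 q)
    (hp_density : ∫ y, p y = 1) (hq_density : ∫ y, q y = 1)
    (hint1 : Integrable (fun y => p y * (deriv (fun z => Real.log (p z)) y) ^ 2))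
    (hint2 : Integrable (fun y => p y * (deriv (fun z => Real.log (q z)) y) ^ 2))
    (hint3 : Integrable (fun y => p y * |deriv (deriv (fun z => Real.log (p z))) y|))
    (hint4 : Integrable (fun y => p y * |deriv (deriv (fun z => Real.log (q z))) y|))
    (hbp_top : Filter.Tendsto (fun y => p y * deriv (fun z => Real.log (p z)) y)
      Filter.atTop (nhds 0))
    (hbp_bot : Filter.Tendsto (fun y => p y * deriv (fun z => Real.log (p z)) y)
      Filter.atBot (nhds 0))
    (hbq_top : Filter.Tendsto (fun y => p y * deriv (fun z => Real.log (q z)) y)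
      Filter.atTop (nhds 0))
    (hbq_bot : Filter.Tendsto (fun y => p y * deriv (fun z => Real.log (q z)) y)
      Filter.atBot (nhds 0)) :
    (∫ y, p y * (hyvarinenScore p y - hyvarinenScore q y)) ≤ 0 ∧
    ((∫ y, p y * (hyvarinenScore p y - hyvarinenScore q y)) = 0 ↔
      ∀ y, deriv (fun z => Real.log (p z)) y = deriv (fun z => Real.log (q z)) y) := by
  set a := deriv (fun z => Real.log (p z)) with ha_def
  set b := deriv (fun z => Real.log (q z)) with hb_def
  have ha : ContDiff ℝ 1 a := contDiff_deriv_log hp_pos hp_smooth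
  have hb : ContDiff ℝ 1 b := contDiff_deriv_log hq_pos hq_smooth
  have hp_nonneg : ∀ y, 0 ≤ p y := fun y => (hp_pos y).le
  have hp_cont : Continuous p := hp_smooth.continuous
  have hsq_int : Integrable (fun y => p y * (a y - b y) ^ 2) :=
    integrable_mul_sub_sq hp_nonneg hp_cont ha.continuous hb.continuous hint1 hint2
  have ha'_int : Integrable (fun y => p y * deriv a y) :=
    integrable_mul_of_integrable_mul_abs hp_nonneg hp_cont (ha.continuous_deriv le_rfl) hint3
  have hb'_int : Integrable (fun y => p y * deriv b y) :=
    integrable_mul_of_integrable_mul_abs hp_nonneg hp_cont (hb.continuous_deriv le_rfl) hint4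
  have hscore_int : Integrable (fun y => p y * (hyvarinenScore p y - hyvarinenScore q y)) := by
    refine (((hint1.sub hint2).const_mul (1 / 2)).add (ha'_int.sub hb'_int)).congr
      (Filter.Eventually.of_forall fun y => ?_)
    simp only [hyvarinenScore, Pi.add_apply, Pi.sub_apply, ← ha_def, ← hb_def]
    ring
  have hderiv : ∀ y, HasDerivAt (fun y => p y * a y - p y * b y)
      (p y * (hyvarinenScore p y - hyvarinenScore q y) + 1 / 2 * (p y * (a y - b y) ^ 2)) y := by
    intro y
    have hp' : HasDerivAt p (p y * a y) y :=
      hasDerivAt_mul_deriv_log (hp_pos y) (hp_smooth.differentiable two_ne_zero y)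
    have ha' := (ha.differentiable one_ne_zero y).hasDerivAt
    have hb' := (hb.differentiable one_ne_zero y).hasDerivAt
    refine ((hp'.mul ha').sub (hp'.mul hb')).congr_deriv ?_
    simp only [hyvarinenScore, ← ha_def, ← hb_def]
    ring
  have hzero := integral_of_hasDerivAt_of_tendsto hderiv (hscore_int.add (hsq_int.const_mul _))
    (hbp_bot.sub hbq_bot) (hbp_top.sub hbq_top)
  rw [integral_add hscore_int (hsq_int.const_mul _), integral_const_mul] at hzero
  have hsq_nonneg : ∀ y, 0 ≤ p y * (a y - b y) ^ 2 :=
    fun y => mul_nonneg (hp_nonneg y) (sq_nonneg _)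
  have hnonneg : 0 ≤ ∫ y, p y * (a y - b y) ^ 2 := integral_nonneg hsq_nonneg
  refine ⟨by linarith, fun h => ?_, fun h => ?_⟩
  · have hsq_zero : ∫ y, p y * (a y - b y) ^ 2 = 0 := by linarith
    have hcont : Continuous fun y => p y * (a y - b y) ^ 2 :=
      hp_cont.mul ((ha.continuous.sub hb.continuous).pow 2)
    have heq := (hcont.ae_eq_iff_eq volume continuous_zero).1
      ((integral_eq_zero_iff_of_nonneg hsq_nonneg hsq_int).1 hsq_zero)
    intro y
    have hy := congrFun heq y
    simpa [(hp_pos y).ne', sub_eq_zero] using hy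
  · simp only [h, sub_self, ne_eq, OfNat.ofNat_ne_zero, not_false_eq_true, zero_pow, mul_zero,
      integral_zero] at hzero
    linarith
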